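/- arXiv:1510.05979 — 3 statements merged into one kernel-verified Lean document; each statement's English description precedes it below -/
import Mathlib

section
/- Let 0 < σ < 1, c = ∫₀¹ (2 sin(πt))^{−σ} dt, and v² = σc/(8π²). If y(t) = E₁ cos(2πt) + E₂ sin(2πt) with E₁, E₂ ∈ ℝ^d orthogonal unit vectors, then 𝒜^σ(y) = ∫₀¹ (v²/2)‖ẏ‖² + (1/2)∫₀¹∫₀¹ ‖y(s) − y(r)‖^{−σ} dr ds = 2π²v²(1 + 2/σ). -/
open MeasureTheory Real Filter Topology intervalIntegral
open scoped RealInnerProductSpace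

theorem norm_sq_smul_add_smul_of_orthonormal {F : Type*} [NormedAddCommGroup F]
    [InnerProductSpace ℝ F] {e f : F} (hef : ⟪e, f⟫ = (0 : ℝ)) (he : ‖e‖ = 1) (hf : ‖f‖ = 1)
    (a b : ℝ) : ‖a • e + b • f‖ ^ 2 = a ^ 2 + b ^ 2 := by
  rw [norm_add_sq_real, real_inner_smul_left, real_inner_smul_right, hef, norm_smul, norm_smul,
    he, hf]
  simp

theorem norm_circle_sub_circle {F : Type*} [NormedAddCommGroup F]
    [InnerProductSpace ℝ F] {e f : F} (hef : ⟪e, f⟫ = (0 : ℝ)) (he : ‖e‖ = 1) (hf : ‖f‖ = 1)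
    (s r : ℝ) :
    ‖(Real.cos (2 * π * s) • e + Real.sin (2 * π * s) • f) -
        (Real.cos (2 * π * r) • e + Real.sin (2 * π * r) • f)‖ =
      2 * |Real.sin (π * (s - r))| := by
  rw [← sq_eq_sq₀ (norm_nonneg _) (by positivity), add_sub_add_comm, ← sub_smul, ← sub_smul,
    norm_sq_smul_add_smul_of_orthonormal hef he hf, mul_pow, sq_abs, Real.sin_sq_eq_half_sub,
    show 2 * (π * (s - r)) = 2 * π * s - 2 * π * r by ring, Real.cos_sub]
  linear_combination Real.sin_sq_add_cos_sq (2 * π * s) + Real.sin_sq_add_cos_sq (2 * π * r)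

theorem hasDerivAt_circle {F : Type*} [NormedAddCommGroup F] [NormedSpace ℝ F] (e f : F)
    (t : ℝ) :
    HasDerivAt (fun t : ℝ => Real.cos (2 * π * t) • e + Real.sin (2 * π * t) • f)
      ((-(2 * π * Real.sin (2 * π * t))) • e + (2 * π * Real.cos (2 * π * t)) • f) t := by
  have h : HasDerivAt (fun t : ℝ => 2 * π * t) (2 * π) t := by
    simpa using (hasDerivAt_id t).const_mul (2 * π)
  exact ((h.cos.smul_const e).add (h.sin.smul_const f)).congr_deriv (by congr 2 <;> ring)

theorem integral_comp_abs_sin_pi_mul_sub (g : ℝ → ℝ) (s : ℝ) :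
    ∫ r in (0 : ℝ)..1, g |Real.sin (π * (s - r))| =
      ∫ t in (0 : ℝ)..1, g (Real.sin (π * t)) := by
  have hper : Function.Periodic (fun t : ℝ => g |Real.sin (π * t)|) 1 := fun t => by
    simp only [mul_add, mul_one, Real.sin_add_pi, abs_neg]
  rw [integral_comp_sub_left (fun t => g |Real.sin (π * t)|)]
  have h := hper.intervalIntegral_add_eq (s - 1) 0
  rw [sub_add_cancel, zero_add] at h
  rw [sub_zero, h]
  refine integral_congr fun t ht => ?_
  rw [Set.uIcc_of_le zero_le_one] at ht
  have hsin : 0 ≤ Real.sin (π * t) :=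
    Real.sin_nonneg_of_nonneg_of_le_pi (mul_nonneg pi_nonneg ht.1)
      (mul_le_of_le_one_right pi_nonneg ht.2)
  simp only [abs_of_nonneg hsin]

/-- Let `0 < σ < 1`, `c = ∫₀¹ (2 sin(πt))^{−σ} dt` and `v² = σc/(8π²)`.
For the unit circle `y(t) = E₁ cos(2πt) + E₂ sin(2πt)`, with `E₁, E₂ ∈ ℝ^d` orthogonal
unit vectors, the action equals
`𝒜^σ(y) = ∫₀¹ (v²/2)‖ẏ‖² + (1/2)∫₀¹∫₀¹ ‖y(s) − y(r)‖^{−σ} = 2π²v²(1 + 2/σ)`. -/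
theorem action_at_circle (d : ℕ) (hd : 2 ≤ d) (σ : ℝ) (hσ0 : 0 < σ) (hσ1 : σ < 1)
    (c : ℝ) (hc : c = ∫ t in (0 : ℝ)..1, (2 * Real.sin (π * t)) ^ (-σ))
    (v : ℝ) (hv : v ^ 2 = σ * c / (8 * π ^ 2))
    (E₁ E₂ : EuclideanSpace ℝ (Fin d))
    (hE : ⟪E₁, E₂⟫ = (0 : ℝ)) (hE₁ : ‖E₁‖ = 1) (hE₂ : ‖E₂‖ = 1)
    (y : ℝ → EuclideanSpace ℝ (Fin d))
    (hy : ∀ t : ℝ, y t = Real.cos (2 * π * t) • E₁ + Real.sin (2 * π * t) • E₂) :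
    (∫ s in (0 : ℝ)..1, v ^ 2 / 2 * ‖deriv y s‖ ^ 2) +
        1 / 2 * ∫ s in (0 : ℝ)..1, ∫ r in (0 : ℝ)..1, ‖y s - y r‖ ^ (-σ) =
      2 * π ^ 2 * v ^ 2 * (1 + 2 / σ) := by
  obtain rfl : y = fun t => Real.cos (2 * π * t) • E₁ + Real.sin (2 * π * t) • E₂ := funext hy
  have hspeed : ∀ s : ℝ, ‖deriv (fun t : ℝ =>
      Real.cos (2 * π * t) • E₁ + Real.sin (2 * π * t) • E₂) s‖ ^ 2 = 4 * π ^ 2 := fun s => by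
    rw [(hasDerivAt_circle E₁ E₂ s).deriv, norm_sq_smul_add_smul_of_orthonormal hE hE₁ hE₂]
    linear_combination 4 * π ^ 2 * Real.sin_sq_add_cos_sq (2 * π * s)
  have hpot : ∀ s : ℝ, ∫ r in (0 : ℝ)..1, (2 * |Real.sin (π * (s - r))|) ^ (-σ) = c := fun s =>
    (integral_comp_abs_sin_pi_mul_sub (fun x => (2 * x) ^ (-σ)) s).trans hc.symm
  simp only [hspeed, norm_circle_sub_circle hE hE₁ hE₂, hpot, intervalIntegral.integral_const, sub_zero,
    one_smul]
  rw [hv]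
  field_simp
  ring
end

section
/- Let 0 < σ < 1, c = ∫₀¹ (2 sin(πt))^{−σ} dt, and v² = σc/(8π²). The action functional 𝒜^σ(y) = ∫₀¹ (v²/2)‖ẏ(s)‖² ds + (1/2)∫₀¹∫₀¹ ‖y(s) − y(r)‖^{−σ} dr ds, defined on the set Λ of 1-periodic functions y : ℝ → ℝ^d with restriction to [0,1] in H¹ and zero mean, attains its absolute minimum exactly at the unit circles: 𝒜^σ(y) is minimal over Λ if and only if y(t) = E₁ cos(2πt) + E₂ sin(2πt) for some orthogonal unit vectors E₁, E₂ ∈ ℝ^d, and the minimal value is 2π²v²(1 + 2/σ). -/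
open MeasureTheory Real Filter Topology intervalIntegral
open scoped RealInnerProductSpace

/-- A function with period one has the same integral over `(0, 1]` as any of its translates. -/
lemma lintegral_Ioc_add_left_of_periodic {F : ℝ → ENNReal} (hF : Function.Periodic F 1)
    (hm : Measurable F) (s : ℝ) :
    ∫⁻ t in Set.Ioc (0 : ℝ) 1, F (s + t) = ∫⁻ t in Set.Ioc (0 : ℝ) 1, F t := by
  have h1 := (measurePreserving_add_left (volume : Measure ℝ) s).setLIntegral_comp_preimage
    (s := Set.Ioc s (s + 1)) measurableSet_Ioc hm
  have h2 : (fun t => s + t) ⁻¹' Set.Ioc s (s + 1) = Set.Ioc (0 : ℝ) 1 := by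
    ext t; simp
  rw [h2] at h1
  rw [h1]
  have h3 := (isAddFundamentalDomain_Ioc zero_lt_one s).setLIntegral_eq
    (isAddFundamentalDomain_Ioc zero_lt_one 0) F hF.map_vadd_zmultiples
  simpa using h3

/-- The integral over the unit square, rewritten in terms of the first variable and the
difference of the two. -/
lemma lintegral_square_eq_of_periodic {H : ℝ × ℝ → ENNReal} (hm : Measurable H)
    (hper : ∀ s, Function.Periodic (fun r => H (s, r)) 1) :
    ∫⁻ p in Set.Ioc (0 : ℝ) 1 ×ˢ Set.Ioc (0 : ℝ) 1, H p =
      ∫⁻ t in Set.Ioc (0 : ℝ) 1, ∫⁻ s in Set.Ioc (0 : ℝ) 1, H (s, s + t) := by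
  rw [Measure.volume_eq_prod, ← Measure.prod_restrict, lintegral_prod _ hm.aemeasurable]
  rw [lintegral_lintegral_swap (f := fun t s => H (s, s + t)) (by fun_prop)]
  refine lintegral_congr fun s => ?_
  exact (lintegral_Ioc_add_left_of_periodic (hper s) (by fun_prop) s).symm

lemma abs_sin_nat_mul_le (n : ℕ) (x : ℝ) : |sin (n * x)| ≤ n * |sin x| := by
  induction n with
  | zero => simp
  | succ n ih =>
    push_cast
    rw [add_mul, one_mul, sin_add]
    calc |sin (n * x) * cos x + cos (n * x) * sin x|
        ≤ |sin (n * x) * cos x| + |cos (n * x) * sin x| := abs_add_le _ _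
      _ = |sin (n * x)| * |cos x| + |cos (n * x)| * |sin x| := by rw [abs_mul, abs_mul]
      _ ≤ |sin (n * x)| * 1 + 1 * |sin x| := by
        gcongr
        · exact abs_cos_le_one _
        · exact abs_cos_le_one _
      _ ≤ (n + 1) * |sin x| := by linarith

lemma abs_sin_int_mul_le (n : ℤ) (x : ℝ) : |sin (n * x)| ≤ |(n : ℝ)| * |sin x| := by
  obtain ⟨k, rfl | rfl⟩ := n.eq_nat_or_neg
  · simpa using abs_sin_nat_mul_le k x
  · simpa using abs_sin_nat_mul_le k x

lemma norm_integral_exp_le {n : ℤ} (hn : n ≠ 0) (t : ℝ) :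
    ‖∫ τ in (0 : ℝ)..t, Complex.exp (2 * π * Complex.I * n * τ)‖ ≤ |sin (π * t)| / π := by
  have hn' : (n : ℂ) ≠ 0 := by exact_mod_cast hn
  have hnr : (0 : ℝ) < |(n : ℝ)| := abs_pos.2 (by exact_mod_cast hn)
  have hc : (2 * π * Complex.I * n : ℂ) ≠ 0 := by
    simp [hn', Real.pi_ne_zero]
  rw [integral_exp_mul_complex hc, norm_div]
  have h1 : (2 * π * Complex.I * n * t : ℂ) = Complex.I * ((2 * (n * (π * t)) : ℝ) : ℂ) := by
    push_cast; ring
  rw [h1]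
  simp only [Complex.ofReal_zero, mul_zero, Complex.exp_zero, Complex.norm_exp_I_mul_ofReal_sub_one]
  have h2 : ‖(2 * π * Complex.I * n : ℂ)‖ = 2 * π * |(n : ℝ)| := by
    simp [abs_of_pos Real.pi_pos]
  rw [h2, div_le_div_iff₀ (by positivity) Real.pi_pos, mul_div_cancel_left₀ _ (two_ne_zero),
    norm_mul, Real.norm_eq_abs, Real.norm_eq_abs, abs_two]
  have := abs_sin_int_mul_le n (π * t)
  nlinarith [Real.pi_pos]

lemma fourierCoeffOn_zero_one (f : ℝ → ℂ) (n : ℤ) :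
    fourierCoeffOn (zero_lt_one (α := ℝ)) f n =
      ∫ x in (0 : ℝ)..1, Complex.exp (-(2 * π * Complex.I * n * x)) * f x := by
  rw [fourierCoeffOn_eq_integral]
  simp only [fourier_coe_apply]
  simp

lemma fourierCoeffOn_increment {u f : ℝ → ℂ} (hf : Function.Periodic f 1) (hfm : Measurable f)
    (hfi : IntervalIntegrable f volume 0 1)
    (hu : ∀ s t, u (s + t) - u s = ∫ τ in (0 : ℝ)..t, f (s + τ)) (t : ℝ) (n : ℤ) :
    fourierCoeffOn (zero_lt_one (α := ℝ)) (fun s => u (s + t) - u s) n =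
      (∫ τ in (0 : ℝ)..t, Complex.exp (2 * π * Complex.I * n * τ)) *
        fourierCoeffOn (zero_lt_one (α := ℝ)) f n := by
  have hfi' : ∀ a b, IntervalIntegrable f volume a b :=
    fun a b => hf.intervalIntegrable₀ one_ne_zero hfi a b
  rw [fourierCoeffOn_zero_one, fourierCoeffOn_zero_one]
  simp only [hu, ← intervalIntegral.integral_const_mul (μ := volume) (a := 0) (b := t)]
  rw [intervalIntegral_intervalIntegral_swap (F := fun s τ : ℝ =>
    Complex.exp (-(2 * π * Complex.I * n * s)) * f (s + τ)),
    ← intervalIntegral.integral_mul_const]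
  · refine intervalIntegral.integral_congr fun τ _ => ?_
    set φ : ℝ → ℂ := fun x => Complex.exp (-(2 * π * Complex.I * n * x)) * f x with hφ
    have hφper : Function.Periodic φ 1 := by
      intro x
      simp only [hφ, hf x]
      congr 1
      rw [Complex.exp_eq_exp_iff_exists_int]
      exact ⟨-n, by push_cast; ring⟩
    have h1 : ∫ x in (0 : ℝ)..1, φ (x + τ) = ∫ x in (0 : ℝ)..1, φ x := by
      rw [intervalIntegral.integral_comp_add_right]
      have := hφper.intervalIntegral_add_eq τ 0
      simpa [add_comm] using this
    rw [← h1, ← intervalIntegral.integral_const_mul]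
    refine intervalIntegral.integral_congr fun s _ => ?_
    simp only [hφ]
    rw [← mul_assoc, ← Complex.exp_add]
    congr 2
    push_cast; ring
  · rw [Measure.volume_eq_prod, IntegrableOn, ← Measure.prod_restrict]
    have hmeas : Measurable (Function.uncurry fun s τ : ℝ =>
        Complex.exp (-(2 * π * Complex.I * n * s)) * f (s + τ)) := by
      unfold Function.uncurry
      fun_prop
    have hnorm : ∀ s τ : ℝ, ‖Complex.exp (-(2 * π * Complex.I * n * s)) * f (s + τ)‖ =
        ‖f (s + τ)‖ := by
      intro s τ
      rw [norm_mul]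
      have : (-(2 * π * Complex.I * n * s) : ℂ) = ((-(2 * π * n * s) : ℝ) : ℂ) * Complex.I := by
        push_cast; ring
      rw [this, Complex.norm_exp_ofReal_mul_I, one_mul]
    rw [integrable_prod_iff' hmeas.aestronglyMeasurable]
    constructor
    · refine ae_of_all _ fun τ => ?_
      rw [← integrable_norm_iff (by unfold Function.uncurry; fun_prop)]
      simp only [Function.uncurry_apply_pair, hnorm]
      have := ((hfi' (0 + τ) (1 + τ)).comp_add_right τ).norm
      simpa [intervalIntegrable_iff, IntegrableOn] using this
    · simp only [Function.uncurry_apply_pair, hnorm]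
      have : ∀ τ : ℝ, ∫ s in Set.uIoc (0 : ℝ) 1, ‖f (s + τ)‖ = ∫ s in (0 : ℝ)..1, ‖f s‖ := by
        intro τ
        rw [Set.uIoc_of_le zero_le_one, ← intervalIntegral.integral_of_le zero_le_one,
          intervalIntegral.integral_comp_add_right (fun s => ‖f s‖)]
        have := Function.Periodic.intervalIntegral_add_eq (f := fun s => ‖f s‖)
          (fun s => congrArg norm (hf s)) τ 0
        simpa [add_comm] using this
      simp only [this]
      have : IsFiniteMeasure (volume.restrict (Set.uIoc 0 t)) := by
        rw [Set.uIoc]; infer_instance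
      exact integrable_const _

/-- A Wirtinger-type inequality: the increments of a periodic function are controlled in `L²` by
its weak derivative, with the sharp constant attained by the first Fourier modes. -/
lemma integral_norm_increment_sq_le {u f : ℝ → ℂ} (hf : Function.Periodic f 1)
    (hfm : Measurable f) (hf2 : MemLp f 2 (volume.restrict (Set.Ioc 0 1)))
    (hu : ∀ s t, u (s + t) - u s = ∫ τ in (0 : ℝ)..t, f (s + τ)) (huc : Continuous u)
    (hup : Function.Periodic u 1) (t : ℝ) :
    ∫ s in (0 : ℝ)..1, ‖u (s + t) - u s‖ ^ 2 ≤
      (sin (π * t) / π) ^ 2 * ∫ s in (0 : ℝ)..1, ‖f s‖ ^ 2 := by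
  have hfi : IntervalIntegrable f volume 0 1 := by
    rw [intervalIntegrable_iff, Set.uIoc_of_le zero_le_one]
    exact hf2.integrable one_le_two
  have hD : MemLp (fun s => u (s + t) - u s) 2 (volume.restrict (Set.Ioc (0 : ℝ) 1)) := by
    have hc : Continuous (fun s => u (s + t) - u s) := by fun_prop
    obtain ⟨C, hC⟩ := isCompact_Icc.exists_bound_of_continuousOn
      (hc.continuousOn (s := Set.Icc 0 1))
    refine MemLp.of_bound hc.aestronglyMeasurable C ?_
    filter_upwards [ae_restrict_mem measurableSet_Ioc] with s hs
    exact hC s (Set.Ioc_subset_Icc_self hs)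
  have h1 := hasSum_sq_fourierCoeffOn zero_lt_one hD
  have h2 := (hasSum_sq_fourierCoeffOn zero_lt_one hf2).mul_left ((sin (π * t) / π) ^ 2)
  simp only [sub_zero, inv_one, one_smul] at h1 h2
  refine hasSum_le (fun n => ?_) h1 h2
  rw [fourierCoeffOn_increment hf hfm hfi hu, norm_mul, mul_pow]
  rcases eq_or_ne n 0 with rfl | hn
  · have h0 : fourierCoeffOn (zero_lt_one (α := ℝ)) f 0 = 0 := by
      rw [fourierCoeffOn_zero_one]
      have := hu 0 1
      have h3 := hup 0
      simp only [zero_add] at this h3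
      simp [← this, h3]
    simp [h0]
  · gcongr ?_ * _
    rw [← sq_abs (sin (π * t) / π), abs_div, abs_of_pos Real.pi_pos]
    gcongr
    exact norm_integral_exp_le hn t

lemma integral_norm_increment_sq_le_euclidean {d : ℕ} {y g : ℝ → EuclideanSpace ℝ (Fin d)}
    (hy : Continuous y) (hyper : Function.Periodic y 1) (hgper : Function.Periodic g 1)
    (hgmeas : Measurable g) (hg2 : MemLp g 2 (volume.restrict (Set.Ioc 0 1)))
    (hinc : ∀ s t, y (s + t) - y s = ∫ τ in (0 : ℝ)..t, g (s + τ)) (t : ℝ) :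
    ∫ s in (0 : ℝ)..1, ‖y (s + t) - y s‖ ^ 2 ≤
      (sin (π * t) / π) ^ 2 * ∫ s in (0 : ℝ)..1, ‖g s‖ ^ 2 := by
  let P : Fin d → EuclideanSpace ℝ (Fin d) →L[ℝ] ℂ :=
    fun i => Complex.ofRealCLM.comp (EuclideanSpace.proj i)
  have hP : ∀ x : EuclideanSpace ℝ (Fin d), ‖x‖ ^ 2 = ∑ i, ‖P i x‖ ^ 2 := by
    intro x
    simp [P, EuclideanSpace.norm_sq_eq]
  have hPg : ∀ i, MemLp (fun s => P i (g s)) 2 (volume.restrict (Set.Ioc 0 1)) :=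
    fun i => (P i).comp_memLp' hg2
  have hgi : IntervalIntegrable g volume 0 1 := by
    rw [intervalIntegrable_iff, Set.uIoc_of_le zero_le_one]
    exact hg2.integrable one_le_two
  simp only [hP]
  rw [intervalIntegral.integral_finsetSum, intervalIntegral.integral_finsetSum, Finset.mul_sum]
  · refine Finset.sum_le_sum fun i _ => ?_
    simp only [map_sub]
    refine integral_norm_increment_sq_le (u := fun s => P i (y s)) (f := fun s => P i (g s))
      (fun s => by simp only [hgper s]) ((P i).measurable.comp hgmeas) (hPg i) (fun s t => ?_)
      ((P i).continuous.comp hy) (fun s => by simp only [hyper s]) t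
    rw [← map_sub, hinc, ContinuousLinearMap.intervalIntegral_comp_comm]
    have := (hgper.intervalIntegrable₀ one_ne_zero hgi (s + 0) (s + t)).comp_add_left s
    simpa using this
  · intro i _
    rw [intervalIntegrable_iff, Set.uIoc_of_le zero_le_one]
    exact (hPg i).integrable_norm_pow (by norm_num)
  · intro i _
    refine Continuous.intervalIntegrable ?_ _ _
    fun_prop

lemma tangent_bound {σ z : ℝ} (hσ : 0 < σ) (hz : 0 < z) :
    1 + σ / 2 ≤ z ^ (-σ) + σ / 2 * z ^ 2 ∧
      (1 + σ / 2 = z ^ (-σ) + σ / 2 * z ^ 2 → z = 1) := by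
  have h1 : 1 - σ * log z ≤ z ^ (-σ) := by
    rw [rpow_def_of_pos hz]
    have := add_one_le_exp (log z * -σ)
    linarith
  have h2 : log (z ^ 2) = 2 * log z := by simp
  refine ⟨?_, fun h => ?_⟩
  · have := log_le_sub_one_of_pos (pow_pos hz 2)
    nlinarith
  · by_contra hne
    have h3 : z ^ 2 ≠ 1 := by
      intro h4
      exact hne ((pow_eq_one_iff_of_nonneg hz.le two_ne_zero).1 h4)
    have := log_lt_sub_one_of_pos (pow_pos hz 2) h3
    nlinarith

lemma rpow_neg_sub_two_mul_sq {ρ σ : ℝ} (hρ : 0 ≤ ρ) (hσ : 0 < σ) :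
    ρ ^ (-σ - 2) * ρ ^ 2 = ρ ^ (-σ) := by
  rcases hρ.eq_or_lt with rfl | hρ
  · rw [zero_rpow (by linarith)]; simp; rw [zero_rpow (by linarith)]
  · rw [← rpow_natCast, ← rpow_add hρ]; norm_num

/-- The tangent line inequality for the convex function `x ↦ x ^ (-σ / 2)` at `ρ ^ 2`, evaluated
at `n ^ 2`. -/
lemma ofReal_rpow_tangent {σ ρ n : ℝ} (hσ : 0 < σ) (hρ : 0 ≤ ρ) (hn : 0 ≤ n) :
    ENNReal.ofReal ((1 + σ / 2) * ρ ^ (-σ)) ≤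
        ENNReal.ofReal n ^ (-σ) + ENNReal.ofReal (σ / 2 * (ρ ^ (-σ - 2) * n ^ 2)) ∧
      (ENNReal.ofReal ((1 + σ / 2) * ρ ^ (-σ)) =
        ENNReal.ofReal n ^ (-σ) + ENNReal.ofReal (σ / 2 * (ρ ^ (-σ - 2) * n ^ 2)) → n = ρ) := by
  rcases hn.eq_or_lt with rfl | hn
  · simp [ENNReal.zero_rpow_of_neg (neg_neg_of_pos hσ)]
  have hA : ENNReal.ofReal n ^ (-σ) = ENNReal.ofReal (n ^ (-σ)) :=
    ENNReal.ofReal_rpow_of_pos hn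
  have hn' : 0 < n ^ (-σ) := rpow_pos_of_pos hn _
  rw [hA, ← ENNReal.ofReal_add hn'.le (by positivity)]
  rcases hρ.eq_or_lt with rfl | hρ
  · rw [zero_rpow (by linarith), zero_rpow (by linarith)]
    simp [hn'.not_ge]
  obtain ⟨z, hz, rfl⟩ : ∃ z, 0 < z ∧ n = ρ * z := ⟨n / ρ, by positivity, by field_simp⟩
  have hρ' : 0 < ρ ^ (-σ) := rpow_pos_of_pos hρ _
  have hB : (ρ * z) ^ (-σ) + σ / 2 * (ρ ^ (-σ - 2) * (ρ * z) ^ 2) =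
      (z ^ (-σ) + σ / 2 * z ^ 2) * ρ ^ (-σ) := by
    rw [mul_pow, ← mul_assoc (ρ ^ (-σ - 2)), rpow_neg_sub_two_mul_sq hρ.le hσ,
      mul_rpow hρ.le hz.le]
    ring
  obtain ⟨h1, h2⟩ := tangent_bound hσ hz
  rw [hB]
  refine ⟨ENNReal.ofReal_le_ofReal (by gcongr), fun h => ?_⟩
  rw [ENNReal.ofReal_eq_ofReal_iff (by positivity) (by positivity)] at h
  rw [h2 (mul_right_cancel₀ hρ'.ne' h), mul_one]

lemma intervalIntegrable_two_sin_rpow {σ : ℝ} (hσ0 : 0 < σ) (hσ1 : σ < 1) :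
    IntervalIntegrable (fun t => (2 * sin (π * t)) ^ (-σ)) volume 0 1 := by
  have h1 : IntervalIntegrable (fun t : ℝ => t ^ (-σ)) volume 0 1 :=
    intervalIntegral.intervalIntegrable_rpow' (by linarith)
  have h2 : IntervalIntegrable (fun t : ℝ => (1 - t) ^ (-σ)) volume 0 1 := by
    simpa using (h1.comp_sub_left 1).symm
  have hm : Measurable (fun t : ℝ => (2 * sin (π * t)) ^ (-σ)) := by fun_prop
  refine (h1.add h2).mono_fun hm.aestronglyMeasurable ?_
  rw [Set.uIoc_of_le zero_le_one, ← restrict_Ioo_eq_restrict_Ioc]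
  filter_upwards [ae_restrict_mem measurableSet_Ioo] with t ht
  have hs : 0 < sin (π * t) := sin_pos_of_pos_of_lt_pi (mul_pos pi_pos ht.1)
    (by nlinarith [pi_pos, ht.2])
  have ht' : 0 < 1 - t := by linarith [ht.2]
  have p1 : 0 ≤ t ^ (-σ) := rpow_nonneg ht.1.le _
  have p2 : 0 ≤ (1 - t) ^ (-σ) := rpow_nonneg ht'.le _
  rw [Real.norm_of_nonneg (by positivity), Real.norm_of_nonneg (by positivity)]
  have key : ∀ x : ℝ, 0 < x → x ≤ 1 / 2 → (2 * sin (π * x)) ^ (-σ) ≤ x ^ (-σ) := by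
    intro x hx hx2
    refine rpow_le_rpow_of_nonpos hx ?_ (by linarith)
    have := mul_le_sin (x := π * x) (by positivity) (by nlinarith [pi_pos])
    have h3 : 2 / π * (π * x) = 2 * x := by field_simp
    linarith
  rcases le_total t (1 / 2) with h | h
  · linarith [key t ht.1 h]
  · have h4 := key (1 - t) ht' (by linarith)
    rw [show π * (1 - t) = π - π * t by ring, sin_pi_sub] at h4
    linarith

lemma abs_two_sin_periodic : Function.Periodic (fun x => |2 * sin (π * x)|) 1 := by
  intro x
  simp only [mul_add, mul_one, sin_add_pi]
  rw [mul_neg, abs_neg]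

lemma abs_two_sin_of_mem_Ioc {t : ℝ} (ht : t ∈ Set.Ioc (0 : ℝ) 1) :
    |2 * sin (π * t)| = 2 * sin (π * t) :=
  abs_of_nonneg (mul_nonneg zero_le_two (sin_nonneg_of_nonneg_of_le_pi
    (mul_nonneg pi_pos.le ht.1.le) (by nlinarith [pi_pos, ht.2])))

lemma lintegral_two_sin_rpow {σ : ℝ} (hσ0 : 0 < σ) (hσ1 : σ < 1) {a : ℝ} (ha : 0 ≤ a) :
    ∫⁻ t in Set.Ioc (0 : ℝ) 1, ENNReal.ofReal (a * |2 * sin (π * t)| ^ (-σ)) =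
      ENNReal.ofReal (a * ∫ t in (0 : ℝ)..1, (2 * sin (π * t)) ^ (-σ)) := by
  have h := intervalIntegrable_two_sin_rpow hσ0 hσ1
  rw [intervalIntegrable_iff, Set.uIoc_of_le zero_le_one] at h
  have h0 : ∀ t ∈ Set.Ioc (0 : ℝ) 1, a * |2 * sin (π * t)| ^ (-σ) =
      a * (2 * sin (π * t)) ^ (-σ) := fun t ht => by rw [abs_two_sin_of_mem_Ioc ht]
  rw [← intervalIntegral.integral_const_mul, intervalIntegral.integral_of_le zero_le_one,
    ofReal_integral_eq_lintegral_ofReal (h.const_mul a)]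
  · exact setLIntegral_congr_fun measurableSet_Ioc fun t ht => by simp only [h0 t ht]
  · filter_upwards [ae_restrict_mem measurableSet_Ioc] with t ht
    rw [← h0 t ht]
    positivity

/-- A periodic zero-mean curve whose chord lengths are those of the unit circle traversed at
constant speed is such a circle. -/
lemma exists_circle_of_chord_length {E : Type*} [NormedAddCommGroup E] [InnerProductSpace ℝ E]
    [CompleteSpace E] {y : ℝ → E} (hy : Continuous y) (hmean : (∫ s in (0 : ℝ)..1, y s) = 0)
    (h : ∀ s r, ‖y s - y r‖ = |2 * sin (π * (r - s))|) :
    ∃ E₁ E₂ : E, ⟪E₁, E₂⟫ = (0 : ℝ) ∧ ‖E₁‖ = 1 ∧ ‖E₂‖ = 1 ∧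
      ∀ t : ℝ, y t = cos (2 * π * t) • E₁ + sin (2 * π * t) • E₂ := by
  have hsq : ∀ s r, ‖y s‖ ^ 2 - 2 * ⟪y s, y r⟫ + ‖y r‖ ^ 2 = 2 - 2 * cos (2 * π * (r - s)) := by
    intro s r
    rw [← norm_sub_sq_real, h, sq_abs, mul_assoc 2 π, cos_two_mul, mul_pow, sin_sq]
    ring
  set M := ∫ r in (0 : ℝ)..1, ‖y r‖ ^ 2 with hM
  have hcos : ∀ s, ∫ r in (0 : ℝ)..1, cos (2 * π * (r - s)) = 0 := by
    intro s
    have h0 : ∀ r : ℝ, cos (2 * π * (r - s)) = cos (2 * π * r - 2 * π * s) := fun r => by ring_nf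
    simp only [h0]
    rw [intervalIntegral.integral_comp_mul_sub _ (by positivity), integral_cos,
      show 2 * π * 1 - 2 * π * s = (2 * π * 0 - 2 * π * s) + 2 * π by ring, sin_add_two_pi]
    simp
  have hnorm : ∀ s, ‖y s‖ ^ 2 + M = 2 := by
    intro s
    have h1 : ∫ r in (0 : ℝ)..1, (‖y s‖ ^ 2 - 2 * ⟪y s, y r⟫ + ‖y r‖ ^ 2) = ‖y s‖ ^ 2 + M := by
      rw [intervalIntegral.integral_add (Continuous.intervalIntegrable (by fun_prop) _ _)
          (Continuous.intervalIntegrable (by fun_prop) _ _),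
        intervalIntegral.integral_sub (Continuous.intervalIntegrable (by fun_prop) _ _)
          (Continuous.intervalIntegrable (by fun_prop) _ _), intervalIntegral.integral_const_mul]
      have h2 := (innerSL ℝ (y s)).intervalIntegral_comp_comm
        (hy.intervalIntegrable (μ := volume) 0 1)
      simp only [innerSL_apply_apply, hmean, inner_zero_right] at h2
      simp [h2, hM]
    rw [← h1]
    simp only [hsq]
    rw [intervalIntegral.integral_sub (Continuous.intervalIntegrable (by fun_prop) _ _)
          (Continuous.intervalIntegrable (by fun_prop) _ _), intervalIntegral.integral_const_mul,
        hcos]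
    simp
  have hM1 : M = 1 := by
    have h1 : ∫ s in (0 : ℝ)..1, ‖y s‖ ^ 2 = ∫ s in (0 : ℝ)..1, (2 - M) :=
      intervalIntegral.integral_congr fun s _ => eq_sub_of_add_eq (hnorm s)
    rw [← hM] at h1
    simp at h1
    linarith
  have hinner : ∀ s r, ⟪y s, y r⟫ = cos (2 * π * (r - s)) := fun s r => by
    linarith [hsq s r, hnorm s, hnorm r]
  have hunit : ∀ s, ‖y s‖ = 1 := fun s =>
    (pow_eq_one_iff_of_nonneg (norm_nonneg _) two_ne_zero).1 (by linarith [hnorm s])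
  have horth : ⟪y 0, y (1 / 4)⟫ = 0 := by
    rw [hinner, show 2 * π * (1 / 4 - 0) = π / 2 by ring, cos_pi_div_two]
  refine ⟨y 0, y (1 / 4), horth, hunit _, hunit _, fun t => ?_⟩
  have h0 : ⟪y t, y 0⟫ = cos (2 * π * t) := by rw [hinner, ← cos_neg]; congr 1; ring
  have h1 : ⟪y t, y (1 / 4)⟫ = sin (2 * π * t) := by
    rw [hinner, ← cos_pi_div_two_sub]; congr 1; ring
  rw [← sub_eq_zero, ← norm_eq_zero, ← sq_eq_zero_iff, norm_sub_sq_real, norm_add_sq_real,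
    inner_add_right, inner_smul_right, inner_smul_right, inner_smul_left, inner_smul_right,
    norm_smul, norm_smul, mul_pow, mul_pow, h0, h1, horth]
  simp only [hunit, Real.norm_eq_abs, sq_abs]
  have := sin_sq_add_cos_sq (2 * π * t)
  simp
  linarith

section Circle

variable {E : Type*} [NormedAddCommGroup E] [InnerProductSpace ℝ E] {E₁ E₂ : E}

lemma norm_sq_smul_add_smul (h12 : ⟪E₁, E₂⟫ = (0 : ℝ)) (h1 : ‖E₁‖ = 1) (h2 : ‖E₂‖ = 1)
    (a b : ℝ) : ‖a • E₁ + b • E₂‖ ^ 2 = a ^ 2 + b ^ 2 := by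
  rw [norm_add_sq_real, inner_smul_left, inner_smul_right, h12, norm_smul, norm_smul, h1, h2]
  simp

lemma norm_circle_sub (h12 : ⟪E₁, E₂⟫ = (0 : ℝ)) (h1 : ‖E₁‖ = 1) (h2 : ‖E₂‖ = 1) (s r : ℝ) :
    ‖(cos (2 * π * s) • E₁ + sin (2 * π * s) • E₂) -
      (cos (2 * π * r) • E₁ + sin (2 * π * r) • E₂)‖ = |2 * sin (π * (r - s))| := by
  rw [← sq_eq_sq₀ (norm_nonneg _) (abs_nonneg _), sq_abs, add_sub_add_comm, ← sub_smul, ← sub_smul,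
    norm_sq_smul_add_smul h12 h1 h2]
  have h3 : cos (2 * π * s - 2 * π * r) = 1 - 2 * sin (π * (r - s)) ^ 2 := by
    rw [← cos_neg, show -(2 * π * s - 2 * π * r) = 2 * (π * (r - s)) by ring, cos_two_mul, cos_sq']
    ring
  rw [cos_sub] at h3
  linarith [sin_sq_add_cos_sq (2 * π * s), sin_sq_add_cos_sq (2 * π * r)]

lemma hasDerivAt_circle_s18 (t : ℝ) :
    HasDerivAt (fun t : ℝ => cos (2 * π * t) • E₁ + sin (2 * π * t) • E₂)
      ((-(2 * π) * sin (2 * π * t)) • E₁ + (2 * π * cos (2 * π * t)) • E₂) t := by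
  have h0 : HasDerivAt (fun t : ℝ => 2 * π * t) (2 * π) t := by
    simpa using (hasDerivAt_id t).const_mul (2 * π)
  refine ((h0.cos.smul_const E₁).fun_add (h0.sin.smul_const E₂)).congr_deriv ?_
  congr 2 <;> ring

/-- The weak derivative of a unit circle has constant speed `2π`. -/
lemma integral_norm_sq_of_circle [CompleteSpace E] (h12 : ⟪E₁, E₂⟫ = (0 : ℝ)) (h1 : ‖E₁‖ = 1)
    (h2 : ‖E₂‖ = 1) {g : ℝ → E} {y₀ : E} (hg : IntervalIntegrable g volume 0 1)
    (hy : ∀ t : ℝ, y₀ + ∫ s in (0 : ℝ)..t, g s =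
      cos (2 * π * t) • E₁ + sin (2 * π * t) • E₂) :
    ∫ s in (0 : ℝ)..1, ‖g s‖ ^ 2 = 4 * π ^ 2 := by
  have h : ∫ s in (0 : ℝ)..1, ‖g s‖ ^ 2 = ∫ s in (0 : ℝ)..1, 4 * π ^ 2 := by
    refine intervalIntegral.integral_congr_ae ?_
    filter_upwards [hg.ae_hasDerivAt_integral] with t ht hmem
    have hd := (ht (Set.uIoc_subset_uIcc hmem) 0 Set.left_mem_uIcc).const_add y₀
    have hfun : (fun t => y₀ + ∫ s in (0 : ℝ)..t, g s) =
        fun t => cos (2 * π * t) • E₁ + sin (2 * π * t) • E₂ := funext hy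
    rw [hfun] at hd
    rw [hd.unique (hasDerivAt_circle_s18 t), norm_sq_smul_add_smul h12 h1 h2]
    linear_combination (4 * π ^ 2) * sin_sq_add_cos_sq (2 * π * t)
  simpa using h

end Circle

lemma lintegral_square_rpow {σ : ℝ} (hσ0 : 0 < σ) (hσ1 : σ < 1) {a : ℝ} (ha : 0 ≤ a) :
    ∫⁻ p in Set.Ioc (0 : ℝ) 1 ×ˢ Set.Ioc (0 : ℝ) 1,
        ENNReal.ofReal (a * |2 * sin (π * (p.2 - p.1))| ^ (-σ)) =
      ENNReal.ofReal (a * ∫ t in (0 : ℝ)..1, (2 * sin (π * t)) ^ (-σ)) := by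
  rw [lintegral_square_eq_of_periodic (by fun_prop), ← lintegral_two_sin_rpow hσ0 hσ1 ha]
  · simp
  · intro s r
    have := abs_two_sin_periodic (r - s)
    simp only at this ⊢
    rw [← this]
    ring_nf

/-- The potential energy of a curve with the chord lengths of the unit circle. -/
lemma lintegral_potential_of_chord_length {E : Type*} [NormedAddCommGroup E] {σ : ℝ} (hσ0 : 0 < σ)
    (hσ1 : σ < 1) {y : ℝ → E} (h : ∀ s r, ‖y s - y r‖ = |2 * sin (π * (r - s))|) :
    ∫⁻ p in Set.Ioc (0 : ℝ) 1 ×ˢ Set.Ioc (0 : ℝ) 1, ENNReal.ofReal ‖y p.1 - y p.2‖ ^ (-σ) =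
      ENNReal.ofReal (∫ t in (0 : ℝ)..1, (2 * sin (π * t)) ^ (-σ)) := by
  simp only [h]
  rw [lintegral_square_eq_of_periodic (by fun_prop)]
  · have h2 := lintegral_two_sin_rpow hσ0 hσ1 zero_le_one
    simp only [one_mul] at h2
    rw [← h2]
    simp only [add_sub_cancel_left, lintegral_const, Measure.restrict_apply_univ, Real.volume_Ioc,
      sub_zero, ENNReal.ofReal_one, mul_one]
    rw [← restrict_Ioo_eq_restrict_Ioc]
    refine setLIntegral_congr_fun measurableSet_Ioo fun t ht => ?_
    refine ENNReal.ofReal_rpow_of_pos (abs_pos.2 (mul_pos two_pos ?_).ne')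
    exact sin_pos_of_pos_of_lt_pi (mul_pos pi_pos ht.1) (by nlinarith [pi_pos, ht.2])
  · intro s r
    have := abs_two_sin_periodic (r - s)
    simp only at this ⊢
    rw [← this]
    ring_nf

lemma lintegral_square_weighted_le {d : ℕ} {σ : ℝ} (hσ0 : 0 < σ) (hσ1 : σ < 1)
    {y g : ℝ → EuclideanSpace ℝ (Fin d)}
    (hy : Continuous y) (hyper : Function.Periodic y 1) (hgper : Function.Periodic g 1)
    (hgmeas : Measurable g) (hg2 : MemLp g 2 (volume.restrict (Set.Ioc 0 1)))
    (hinc : ∀ s t, y (s + t) - y s = ∫ τ in (0 : ℝ)..t, g (s + τ)) :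
    ∫⁻ p in Set.Ioc (0 : ℝ) 1 ×ˢ Set.Ioc (0 : ℝ) 1, ENNReal.ofReal
        (σ / 2 * (|2 * sin (π * (p.2 - p.1))| ^ (-σ - 2) * ‖y p.1 - y p.2‖ ^ 2)) ≤
      ENNReal.ofReal (σ / (8 * π ^ 2) * (∫ s in (0 : ℝ)..1, ‖g s‖ ^ 2) *
        ∫ t in (0 : ℝ)..1, (2 * sin (π * t)) ^ (-σ)) := by
  have hG : 0 ≤ ∫ s in (0 : ℝ)..1, ‖g s‖ ^ 2 :=
    intervalIntegral.integral_nonneg zero_le_one fun s _ => by positivity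
  have hym := hy.measurable
  rw [lintegral_square_eq_of_periodic (by fun_prop),
    ← lintegral_two_sin_rpow hσ0 hσ1 (by positivity)]
  · refine lintegral_mono fun t => ?_
    simp only [add_sub_cancel_left]
    have hint : IntegrableOn (fun s => σ / 2 * (|2 * sin (π * t)| ^ (-σ - 2) *
        ‖y s - y (s + t)‖ ^ 2)) (Set.Ioc 0 1) := by
      refine Continuous.integrableOn_Ioc ?_
      fun_prop
    rw [← ofReal_integral_eq_lintegral_ofReal hint (ae_of_all _ fun s => by positivity)]
    refine ENNReal.ofReal_le_ofReal ?_
    rw [MeasureTheory.integral_const_mul, MeasureTheory.integral_const_mul,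
      ← intervalIntegral.integral_of_le zero_le_one]
    have h := integral_norm_increment_sq_le_euclidean hy hyper hgper hgmeas hg2 hinc t
    simp only [norm_sub_rev (y _) (y (_ + t))]
    calc σ / 2 * (|2 * sin (π * t)| ^ (-σ - 2) * ∫ s in (0 : ℝ)..1, ‖y (s + t) - y s‖ ^ 2)
        ≤ σ / 2 * (|2 * sin (π * t)| ^ (-σ - 2) *
          ((sin (π * t) / π) ^ 2 * ∫ s in (0 : ℝ)..1, ‖g s‖ ^ 2)) := by gcongr
      _ = σ / (8 * π ^ 2) * (∫ s in (0 : ℝ)..1, ‖g s‖ ^ 2) *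
          (|2 * sin (π * t)| ^ (-σ - 2) * |2 * sin (π * t)| ^ 2) := by
        rw [sq_abs]
        field_simp
        ring
      _ = _ := by rw [rpow_neg_sub_two_mul_sq (abs_nonneg _) hσ0]
  · intro s r
    have := abs_two_sin_periodic (r - s)
    simp only [hyper r] at this ⊢
    rw [← this]
    ring_nf

lemma chord_length_of_ae {E : Type*} [NormedAddCommGroup E] {y : ℝ → E} (hy : Continuous y)
    (hyper : Function.Periodic y 1)
    (h : ∀ᵐ p ∂(volume.restrict (Set.Ioc (0 : ℝ) 1 ×ˢ Set.Ioc (0 : ℝ) 1)),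
      ‖y p.1 - y p.2‖ = |2 * sin (π * (p.2 - p.1))|) (s r : ℝ) :
    ‖y s - y r‖ = |2 * sin (π * (r - s))| := by
  have hsub : Set.Ioc (0 : ℝ) 1 ×ˢ Set.Ioc (0 : ℝ) 1 ⊆
      closure (interior (Set.Ioc (0 : ℝ) 1 ×ˢ Set.Ioc (0 : ℝ) 1)) := by
    rw [interior_prod_eq, closure_prod_eq]
    exact Set.prod_mono (Ioc_subset_closure_interior _ _) (Ioc_subset_closure_interior _ _)
  have heq := Measure.eqOn_of_ae_eq h (by fun_prop) (by fun_prop) hsub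
  have step : ∀ s r : ℝ, ∀ n : ℤ, |2 * sin (π * (r + n - s))| = |2 * sin (π * (r - s))| := by
    intro s r n
    have := (abs_two_sin_periodic.int_mul n) (r - s)
    simp only [mul_one] at this
    rw [← this]
    ring_nf
  obtain ⟨m, hm, -⟩ := existsUnique_add_zsmul_mem_Ioc (zero_lt_one (α := ℝ)) s 0
  obtain ⟨n, hn, -⟩ := existsUnique_add_zsmul_mem_Ioc (zero_lt_one (α := ℝ)) r 0
  simp only [zsmul_eq_mul, mul_one, zero_add] at hm hn
  have hyi : ∀ (x : ℝ) (k : ℤ), y (x + k) = y x := fun x k => by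
    simpa using (hyper.int_mul k) x
  have := heq (Set.mk_mem_prod hm hn)
  simp only [hyi] at this
  rw [this, step, ← abs_neg, ← mul_neg, ← sin_neg,
    show -(π * (r - (s + m))) = π * (s + m - r) by ring, step, ← abs_neg, ← mul_neg, ← sin_neg]
  congr 3
  ring

/-- Let `0 < σ < 1`, `c = ∫₀¹ (2 sin(πt))^{−σ} dt` and `v² = σc/(8π²)`.
The action `𝒜^σ(y) = ∫₀¹ (v²/2)‖ẏ‖² + (1/2)∫₀¹∫₀¹ ‖y(s) − y(r)‖^{−σ}` (valued in
`[0,∞]`), defined on the set `Λ` of 1-periodic zero-mean `H¹` functions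
`y : ℝ → ℝ^d` (represented by `y(t) = y(0) + ∫₀ᵗ g` with `g` its 1-periodic weak
derivative, square-integrable on `[0,1]`), attains its absolute minimum exactly at the
unit circles: every `y ∈ Λ` satisfies `𝒜^σ(y) ≥ 2π²v²(1 + 2/σ)`, with equality if and
only if `y(t) = E₁ cos(2πt) + E₂ sin(2πt)` for some orthogonal unit vectors
`E₁, E₂ ∈ ℝ^d`; in particular the minimal value is `2π²v²(1 + 2/σ)`. -/
theorem action_min_at_circles (d : ℕ) (hd : 2 ≤ d) (σ : ℝ) (hσ0 : 0 < σ) (hσ1 : σ < 1)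
    (c : ℝ) (hc : c = ∫ t in (0 : ℝ)..1, (2 * Real.sin (π * t)) ^ (-σ))
    (v : ℝ) (hv : v ^ 2 = σ * c / (8 * π ^ 2))
    (y g : ℝ → EuclideanSpace ℝ (Fin d))
    (hyper : Function.Periodic y 1)
    (hgper : Function.Periodic g 1)
    (hgmeas : Measurable g)
    (hgL2 : IntegrableOn (fun s => ‖g s‖ ^ 2) (Set.Icc 0 1))
    (hfund : ∀ t : ℝ, y t = y 0 + ∫ s in (0 : ℝ)..t, g s)
    (hmean : (∫ s in (0 : ℝ)..1, y s) = 0) :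
    ENNReal.ofReal (2 * π ^ 2 * v ^ 2 * (1 + 2 / σ)) ≤
        ENNReal.ofReal (∫ s in (0 : ℝ)..1, v ^ 2 / 2 * ‖g s‖ ^ 2) +
          2⁻¹ * ∫⁻ p in Set.Ioc (0 : ℝ) 1 ×ˢ Set.Ioc (0 : ℝ) 1,
            ENNReal.ofReal ‖y p.1 - y p.2‖ ^ (-σ) ∧
      ((ENNReal.ofReal (∫ s in (0 : ℝ)..1, v ^ 2 / 2 * ‖g s‖ ^ 2) +
            2⁻¹ * ∫⁻ p in Set.Ioc (0 : ℝ) 1 ×ˢ Set.Ioc (0 : ℝ) 1,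
              ENNReal.ofReal ‖y p.1 - y p.2‖ ^ (-σ)) =
          ENNReal.ofReal (2 * π ^ 2 * v ^ 2 * (1 + 2 / σ)) ↔
        ∃ E₁ E₂ : EuclideanSpace ℝ (Fin d), ⟪E₁, E₂⟫ = (0 : ℝ) ∧ ‖E₁‖ = 1 ∧ ‖E₂‖ = 1 ∧
          ∀ t : ℝ, y t = Real.cos (2 * π * t) • E₁ + Real.sin (2 * π * t) • E₂) := by
  have hg2 : MemLp g 2 (volume.restrict (Set.Ioc 0 1)) := by
    rw [memLp_two_iff_integrable_sq_norm hgmeas.aestronglyMeasurable]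
    exact hgL2.mono_set Set.Ioc_subset_Icc_self
  have hgi : IntervalIntegrable g volume 0 1 := by
    rw [intervalIntegrable_iff, Set.uIoc_of_le zero_le_one]
    exact hg2.integrable one_le_two
  have hgi' : ∀ a b, IntervalIntegrable g volume a b :=
    fun a b => hgper.intervalIntegrable₀ one_ne_zero hgi a b
  have hy : Continuous y := by
    rw [show y = fun t => y 0 + ∫ s in (0 : ℝ)..t, g s from funext hfund]
    exact continuous_const.add (intervalIntegral.continuous_primitive hgi' 0)
  have hinc : ∀ s t, y (s + t) - y s = ∫ τ in (0 : ℝ)..t, g (s + τ) := by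
    intro s t
    rw [intervalIntegral.integral_comp_add_left, hfund (s + t), hfund s, add_sub_add_left_eq_sub,
      intervalIntegral.integral_interval_sub_left (hgi' _ _) (hgi' _ _), add_zero]
  have hym := hy.measurable
  have hc0 : 0 ≤ c := by
    rw [hc]
    refine intervalIntegral.integral_nonneg zero_le_one fun t ht => rpow_nonneg ?_ _
    exact mul_nonneg zero_le_two (sin_nonneg_of_nonneg_of_le_pi
      (mul_nonneg pi_pos.le ht.1) (by nlinarith [pi_pos, ht.2]))
  set G := ∫ s in (0 : ℝ)..1, ‖g s‖ ^ 2 with hG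
  have hG0 : 0 ≤ G := intervalIntegral.integral_nonneg zero_le_one fun s _ => by positivity
  rw [intervalIntegral.integral_const_mul, ← hG]
  set A := fun p : ℝ × ℝ => ENNReal.ofReal ‖y p.1 - y p.2‖ ^ (-σ) with hA
  set B := fun p : ℝ × ℝ => ENNReal.ofReal
    (σ / 2 * (|2 * sin (π * (p.2 - p.1))| ^ (-σ - 2) * ‖y p.1 - y p.2‖ ^ 2)) with hB
  set L := fun p : ℝ × ℝ => ENNReal.ofReal
    ((1 + σ / 2) * |2 * sin (π * (p.2 - p.1))| ^ (-σ)) with hL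
  set S := Set.Ioc (0 : ℝ) 1 ×ˢ Set.Ioc (0 : ℝ) 1 with hS
  have hAm : Measurable A := by fun_prop
  have hBm : Measurable B := by fun_prop
  have hLAB : ∀ p, L p ≤ A p + B p := fun p =>
    (ofReal_rpow_tangent hσ0 (abs_nonneg _) (norm_nonneg _)).1
  have hIL : ∫⁻ p in S, L p = ENNReal.ofReal ((1 + σ / 2) * c) := by
    rw [hc]
    exact lintegral_square_rpow hσ0 hσ1 (by positivity)
  have htwo : (2⁻¹ : ENNReal) = ENNReal.ofReal 2⁻¹ := by
    rw [ENNReal.ofReal_inv_of_pos two_pos]; simp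
  have hT : ENNReal.ofReal (2 * π ^ 2 * v ^ 2 * (1 + 2 / σ)) = 2⁻¹ * ∫⁻ p in S, L p := by
    rw [hIL, htwo, ← ENNReal.ofReal_mul (by norm_num), hv]
    congr 1
    field_simp
    ring
  have hK : 2⁻¹ * ∫⁻ p in S, B p ≤ ENNReal.ofReal (v ^ 2 / 2 * G) := by
    have h1 : ∫⁻ p in S, B p ≤ ENNReal.ofReal (σ / (8 * π ^ 2) * G * c) := by
      rw [hc]
      exact lintegral_square_weighted_le hσ0 hσ1 hy hyper hgper hgmeas hg2 hinc
    calc 2⁻¹ * ∫⁻ p in S, B p ≤ 2⁻¹ * ENNReal.ofReal (σ / (8 * π ^ 2) * G * c) := by gcongr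
      _ = ENNReal.ofReal (v ^ 2 / 2 * G) := by
        rw [htwo, ← ENNReal.ofReal_mul (by norm_num), hv]
        congr 1
        ring
  have hAB : 2⁻¹ * ∫⁻ p in S, (A p + B p) ≤
      ENNReal.ofReal (v ^ 2 / 2 * G) + 2⁻¹ * ∫⁻ p in S, A p := by
    rw [lintegral_add_left hAm, mul_add, add_comm]
    gcongr
  rw [hT]
  refine ⟨le_trans (by gcongr; exact hLAB _) hAB, fun heq => ?_, ?_⟩
  · have hle : ∫⁻ p in S, (A p + B p) ≤ ∫⁻ p in S, L p :=
      (ENNReal.mul_le_mul_iff_right (by simp) (by simp)).1 (hAB.trans heq.le)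
    have hae := ae_eq_of_ae_le_of_lintegral_le (ae_of_all _ hLAB) (by rw [hIL]; simp)
      (hAm.add hBm).aemeasurable hle
    refine exists_circle_of_chord_length hy hmean (chord_length_of_ae hy hyper ?_)
    filter_upwards [hae] with p hp
    exact (ofReal_rpow_tangent hσ0 (abs_nonneg _) (norm_nonneg _)).2 hp
  · rintro ⟨E₁, E₂, h12, h1, h2, hcirc⟩
    have hchord : ∀ s r, ‖y s - y r‖ = |2 * sin (π * (r - s))| := fun s r => by
      rw [hcirc, hcirc, norm_circle_sub h12 h1 h2]
    have hG4 : G = 4 * π ^ 2 := integral_norm_sq_of_circle h12 h1 h2 hgi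
      (fun t => by rw [← hcirc, ← hfund])
    have hIA : ∫⁻ p in S, A p = ENNReal.ofReal c := by
      rw [hc]
      exact lintegral_potential_of_chord_length hσ0 hσ1 hchord
    rw [hIA, hIL, htwo, ← ENNReal.ofReal_mul (by norm_num), ← ENNReal.ofReal_mul (by norm_num),
      ← ENNReal.ofReal_add (by positivity) (by positivity), hG4, hv]
    congr 1
    field_simp
    ring
end

section
/- Let 0 < σ < 1 and let y : ℝ → ℝ^d be a 1-periodic zero-mean H¹ function that is not almost everywhere constant. With c = ∫₀¹ (2 sin(πt))^{−σ} dt, μ(s) = (2 sin(πs))^{−2−σ}/c, and ξ_y(t) = ∫₀¹ ‖y(s+t) − y(s)‖² ds, one has ∫₀¹∫₀¹ ‖y(s) − y(r)‖^{−σ} dr ds ≥ c · (∫₀¹ μ ξ_y)^{−σ/2}. -/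
open MeasureTheory Real Filter Topology intervalIntegral

/-- The tangent-line inequality at `a` for the convex function `x ↦ x ^ (-p)`. -/
lemma rpow_neg_tangent_le {p a x : ℝ} (hp : 0 < p) (ha : 0 < a) (hx : 0 < x) :
    a ^ (-p) * (1 + p - p * (x / a)) ≤ x ^ (-p) := by
  have hu : 0 < x / a := div_pos hx ha
  have hlog : Real.log (x / a) ≤ x / a - 1 := Real.log_le_sub_one_of_pos hu
  have hexp : 1 + p - p * (x / a) ≤ (x / a) ^ (-p) := by
    rw [Real.rpow_def_of_pos hu]
    have h1 := Real.add_one_le_exp (Real.log (x / a) * -p)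
    nlinarith
  calc a ^ (-p) * (1 + p - p * (x / a)) ≤ a ^ (-p) * (x / a) ^ (-p) := by gcongr
    _ = x ^ (-p) := by
      rw [← Real.mul_rpow ha.le hu.le, mul_div_cancel₀ _ ha.ne']

/-- The tangent-line inequality for `δ ↦ δ ^ (-σ)` as a function of `δ ^ 2 / w ^ 2`, valid
also at `δ = 0` in `[0, ∞]`. -/
lemma ofReal_tangent_le_ofReal_rpow {σ a w δ : ℝ} (hσ : 0 < σ) (ha : 0 < a) (hw : 0 < w)
    (hδ : 0 ≤ δ) :
    ENNReal.ofReal (a ^ (-(σ / 2)) *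
        ((1 + σ / 2) * w ^ (-σ) - σ / 2 / a * (w ^ (-(2 + σ)) * δ ^ 2))) ≤
      ENNReal.ofReal δ ^ (-σ) := by
  rcases hδ.eq_or_lt with rfl | hδ
  · simp [ENNReal.zero_rpow_of_neg (neg_lt_zero.2 hσ)]
  rw [ENNReal.ofReal_rpow_of_pos hδ]
  apply ENNReal.ofReal_le_ofReal
  have hr : 0 < δ / w := div_pos hδ hw
  have h := rpow_neg_tangent_le (half_pos hσ) ha (pow_pos hr 2)
  have hpow : ((δ / w) ^ 2) ^ (-(σ / 2)) = δ ^ (-σ) / w ^ (-σ) := by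
    rw [← Real.rpow_natCast, ← Real.rpow_mul hr.le, ← Real.div_rpow hδ.le hw.le]
    congr 1
    push_cast
    ring
  have hwpow : w ^ (-(2 + σ)) = w ^ (-σ) / w ^ 2 := by
    rw [← Real.rpow_natCast, ← Real.rpow_sub hw]
    congr 1
    push_cast
    ring
  rw [hpow, le_div_iff₀ (Real.rpow_pos_of_pos hw _)] at h
  rw [hwpow]
  refine le_of_eq_of_le ?_ h
  rw [div_pow]
  field_simp

lemma ofReal_integral_le_lintegral_ofReal {α : Type*} {m : MeasurableSpace α} {ν : Measure α}
    (f : α → ℝ) :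
    ENNReal.ofReal (∫ x, f x ∂ν) ≤ ∫⁻ x, ENNReal.ofReal (f x) ∂ν := by
  by_cases hf : Integrable f ν
  · calc ENNReal.ofReal (∫ x, f x ∂ν) ≤ ENNReal.ofReal (∫ x, max (f x) 0 ∂ν) :=
          ENNReal.ofReal_le_ofReal
            (integral_mono hf hf.pos_part fun x => le_max_left _ _)
      _ = ∫⁻ x, ENNReal.ofReal (max (f x) 0) ∂ν :=
          ofReal_integral_eq_lintegral_ofReal hf.pos_part
            (Filter.Eventually.of_forall fun x => le_max_right _ _)
      _ = ∫⁻ x, ENNReal.ofReal (f x) ∂ν := by simp [ENNReal.ofReal_max]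
  · simp [integral_undef hf]

/-- The integral of a periodic `[0, ∞]`-valued function over a period is translation invariant. -/
lemma Function.Periodic.setLIntegral_add_left {f : ℝ → ENNReal} (hf : Function.Periodic f 1)
    (r : ℝ) :
    ∫⁻ t in Set.Ioc (0 : ℝ) 1, f (r + t) = ∫⁻ s in Set.Ioc (0 : ℝ) 1, f s := by
  have hpre : (fun t : ℝ => r + t) ⁻¹' Set.Ioc r (r + 1) = Set.Ioc 0 1 := by
    simp
  have h1 : ∫⁻ t in Set.Ioc (0 : ℝ) 1, f (r + t) = ∫⁻ s in Set.Ioc r (r + 1), f s := by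
    rw [← hpre]
    exact (measurePreserving_add_left volume r).setLIntegral_comp_preimage_emb
      (measurableEmbedding_addLeft r) f _
  have : VAddInvariantMeasure (AddSubgroup.zmultiples (1 : ℝ)) ℝ volume :=
    ⟨fun c s _ => measure_preimage_add _ _ _⟩
  rw [h1]
  have h0 := isAddFundamentalDomain_Ioc (one_pos : (0 : ℝ) < 1) 0
  rw [zero_add] at h0
  refine (isAddFundamentalDomain_Ioc one_pos r).setLIntegral_eq h0 f ?_
  rintro ⟨_, n, rfl⟩ x
  simpa [add_comm] using hf.int_mul n x

/-- A periodic kernel integrated over the square, in the variables difference and base point. -/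
lemma lintegral_prod_eq_lintegral_translate {F : ℝ → ℝ → ENNReal}
    (hF : Measurable (Function.uncurry F)) (hper : ∀ r, Function.Periodic (fun s => F s r) 1) :
    ∫⁻ p in Set.Ioc (0 : ℝ) 1 ×ˢ Set.Ioc (0 : ℝ) 1, F p.1 p.2 =
      ∫⁻ t in Set.Ioc (0 : ℝ) 1, ∫⁻ s in Set.Ioc (0 : ℝ) 1, F (s + t) s := by
  rw [Measure.volume_eq_prod, setLIntegral_prod_symm (fun p => F p.1 p.2) hF.aemeasurable]
  have hshift : ∀ r, ∫⁻ s in Set.Ioc (0 : ℝ) 1, F s r =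
      ∫⁻ t in Set.Ioc (0 : ℝ) 1, F (r + t) r := fun r =>
    ((hper r).setLIntegral_add_left r).symm
  simp only [hshift]
  refine lintegral_lintegral_swap (Measurable.aemeasurable ?_)
  exact hF.comp ((measurable_fst.add measurable_snd).prodMk measurable_fst)

lemma continuous_of_eq_add_primitive {E : Type*} [NormedAddCommGroup E] [NormedSpace ℝ E]
    {y g : ℝ → E} (hgper : Function.Periodic g 1)
    (hgmeas : AEStronglyMeasurable g) (hgL2 : IntegrableOn (fun s => ‖g s‖ ^ 2) (Set.Icc 0 1))
    (hfund : ∀ t : ℝ, y t = y 0 + ∫ s in (0 : ℝ)..t, g s) : Continuous y := by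
  have hint : IntervalIntegrable g volume 0 1 := by
    rw [intervalIntegrable_iff_integrableOn_Icc_of_le zero_le_one]
    have hL2 : MemLp g 2 (volume.restrict (Set.Icc 0 1)) :=
      (memLp_two_iff_integrable_sq_norm hgmeas.restrict).2 hgL2
    exact hL2.integrable one_le_two
  have hloc := hgper.intervalIntegrable₀ one_ne_zero hint
  rw [funext hfund]
  exact continuous_const.add (intervalIntegral.continuous_primitive hloc 0)

/-- Let `0 < σ < 1`, `c = ∫₀¹ (2 sin(πt))^{−σ} dt`,
`μ(s) = (2 sin(πs))^{−2−σ}/c`, and `ξ_y(t) = ∫₀¹ ‖y(s+t) − y(s)‖² ds`. For a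
1-periodic zero-mean `H¹` function `y : ℝ → ℝ^d` (represented by `y(t) = y(0) + ∫₀ᵗ g`)
that is not almost everywhere constant, one has
`∫₀¹∫₀¹ ‖y(s) − y(r)‖^{−σ} dr ds ≥ c · (∫₀¹ μ ξ_y)^{−σ/2}` (the left-hand side valued
in `[0,∞]`). -/
theorem potential_lower_bound (d : ℕ) (hd : 2 ≤ d) (σ : ℝ) (hσ0 : 0 < σ) (hσ1 : σ < 1)
    (c : ℝ) (hc : c = ∫ t in (0 : ℝ)..1, (2 * Real.sin (π * t)) ^ (-σ))
    (μ : ℝ → ℝ)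
    (hμ : ∀ s ∈ Set.Ioo (0 : ℝ) 1, μ s = (2 * Real.sin (π * s)) ^ (-(2 + σ)) / c)
    (y g : ℝ → EuclideanSpace ℝ (Fin d))
    (hyper : Function.Periodic y 1)
    (hgper : Function.Periodic g 1)
    (hgmeas : Measurable g)
    (hgL2 : IntegrableOn (fun s => ‖g s‖ ^ 2) (Set.Icc 0 1))
    (hfund : ∀ t : ℝ, y t = y 0 + ∫ s in (0 : ℝ)..t, g s)
    (hmean : (∫ s in (0 : ℝ)..1, y s) = 0)
    (hnc : ¬ ∃ C : EuclideanSpace ℝ (Fin d),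
      ∀ᵐ s ∂(volume.restrict (Set.Icc (0 : ℝ) 1)), y s = C) :
    ENNReal.ofReal
        (c * (∫ t in (0 : ℝ)..1, μ t * ∫ s in (0 : ℝ)..1, ‖y (s + t) - y s‖ ^ 2) ^
          (-(σ / 2))) ≤
      ∫⁻ p in Set.Ioc (0 : ℝ) 1 ×ˢ Set.Ioc (0 : ℝ) 1,
        ENNReal.ofReal ‖y p.1 - y p.2‖ ^ (-σ) := by
  have hy : Continuous y :=
    continuous_of_eq_add_primitive hgper hgmeas.aestronglyMeasurable hgL2 hfund
  set w : ℝ → ℝ := fun t => 2 * Real.sin (π * t) with hw_def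
  have hw : ∀ t ∈ Set.Ioo (0 : ℝ) 1, 0 < w t := fun t ht => by
    have := Real.sin_pos_of_pos_of_lt_pi (mul_pos Real.pi_pos ht.1)
      (by nlinarith [Real.pi_pos, ht.2])
    simp only [hw_def]
    positivity
  set ξ : ℝ → ℝ := fun t => ∫ s in (0 : ℝ)..1, ‖y (s + t) - y s‖ ^ 2 with hξ_def
  have hξ : ∀ t, 0 ≤ ξ t := fun t =>
    intervalIntegral.integral_nonneg zero_le_one fun s _ => by positivity
  set a : ℝ := ∫ t in (0 : ℝ)..1, μ t * ξ t with ha_def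
  change ENNReal.ofReal (c * a ^ (-(σ / 2))) ≤ _
  have hc_Ioo : c = ∫ t in Set.Ioo (0 : ℝ) 1, w t ^ (-σ) := by
    rw [hc, intervalIntegral.integral_of_le zero_le_one, integral_Ioc_eq_integral_Ioo]
  have ha_Ioo : a = ∫ t in Set.Ioo (0 : ℝ) 1, w t ^ (-(2 + σ)) / c * ξ t := by
    rw [ha_def, intervalIntegral.integral_of_le zero_le_one, integral_Ioc_eq_integral_Ioo]
    exact setIntegral_congr_fun measurableSet_Ioo fun t ht => by simp only [hμ t ht, hw_def]
  have hc0 : 0 ≤ c := by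
    rw [hc_Ioo]
    exact setIntegral_nonneg measurableSet_Ioo fun t ht => Real.rpow_nonneg (hw t ht).le _
  have ha0 : 0 ≤ a := by
    rw [ha_Ioo]
    exact setIntegral_nonneg measurableSet_Ioo fun t ht =>
      mul_nonneg (div_nonneg (Real.rpow_nonneg (hw t ht).le _) hc0) (hξ t)
  rcases hc0.eq_or_lt with hc0 | hc0
  · simp [← hc0]
  rcases ha0.eq_or_lt with ha0 | ha0
  · simp [← ha0, Real.zero_rpow (neg_ne_zero.2 (half_pos hσ0).ne')]
  have hc_int : IntegrableOn (fun t => w t ^ (-σ)) (Set.Ioo 0 1) :=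
    not_imp_comm.1 integral_undef (hc_Ioo ▸ hc0.ne')
  have ha_int : IntegrableOn (fun t => w t ^ (-(2 + σ)) / c * ξ t) (Set.Ioo 0 1) :=
    not_imp_comm.1 integral_undef (ha_Ioo ▸ ha0.ne')
  have hmeas : Measurable
      (Function.uncurry fun s r => ENNReal.ofReal ‖y s - y r‖ ^ (-σ)) :=
    (ENNReal.measurable_ofReal.comp
      ((hy.comp continuous_fst).sub (hy.comp continuous_snd)).norm.measurable).pow_const _
  rw [lintegral_prod_eq_lintegral_translate
    (F := fun s r => ENNReal.ofReal ‖y s - y r‖ ^ (-σ)) hmeas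
    (fun r s => by simp only [hyper s])]
  set φ : ℝ → ℝ := fun t =>
    a ^ (-(σ / 2)) * ((1 + σ / 2) * w t ^ (-σ) - σ / 2 / a * (w t ^ (-(2 + σ)) * ξ t)) with hφ_def
  have hslice : ∀ t ∈ Set.Ioo (0 : ℝ) 1, ENNReal.ofReal (φ t) ≤
      ∫⁻ s in Set.Ioc (0 : ℝ) 1, ENNReal.ofReal ‖y (s + t) - y s‖ ^ (-σ) := by
    intro t ht
    have hsq : IntegrableOn (fun s => ‖y (s + t) - y s‖ ^ 2) (Set.Ioc 0 1) :=
      (Continuous.integrableOn_Icc (by fun_prop)).mono_set Set.Ioc_subset_Icc_self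
    have hφ : φ t = ∫ s in Set.Ioc (0 : ℝ) 1, a ^ (-(σ / 2)) *
        ((1 + σ / 2) * w t ^ (-σ) - σ / 2 / a * (w t ^ (-(2 + σ)) * ‖y (s + t) - y s‖ ^ 2)) := by
      rw [MeasureTheory.integral_const_mul,
        MeasureTheory.integral_sub (integrable_const _) ((hsq.const_mul _).const_mul _),
        MeasureTheory.integral_const_mul, MeasureTheory.integral_const_mul,
        MeasureTheory.integral_const_mul]
      simp [hφ_def, hξ_def, intervalIntegral.integral_of_le zero_le_one]
    rw [hφ]
    exact (ofReal_integral_le_lintegral_ofReal _).trans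
      (lintegral_mono fun s => ofReal_tangent_le_ofReal_rpow hσ0 ha0 (hw t ht) (norm_nonneg _))
  have hφ_integral : ∫ t in Set.Ioo (0 : ℝ) 1, φ t = c * a ^ (-(σ / 2)) := by
    have hφ_eq : φ = fun t => a ^ (-(σ / 2)) * ((1 + σ / 2) * w t ^ (-σ) -
        σ / 2 / a * c * (w t ^ (-(2 + σ)) / c * ξ t)) := by
      funext t
      simp only [hφ_def]
      field_simp
    rw [hφ_eq, MeasureTheory.integral_const_mul,
      MeasureTheory.integral_sub (hc_int.const_mul _) (ha_int.const_mul _),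
      MeasureTheory.integral_const_mul, MeasureTheory.integral_const_mul, ← hc_Ioo, ← ha_Ioo]
    field_simp
    ring
  rw [← hφ_integral]
  calc ENNReal.ofReal (∫ t in Set.Ioo (0 : ℝ) 1, φ t)
      ≤ ∫⁻ t in Set.Ioo (0 : ℝ) 1, ENNReal.ofReal (φ t) := ofReal_integral_le_lintegral_ofReal _
    _ ≤ ∫⁻ t in Set.Ioo (0 : ℝ) 1, ∫⁻ s in Set.Ioc (0 : ℝ) 1,
          ENNReal.ofReal ‖y (s + t) - y s‖ ^ (-σ) := setLIntegral_mono' measurableSet_Ioo hslice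
    _ ≤ _ := lintegral_mono_set Set.Ioo_subset_Ioc_self
end
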